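/- Let a ∈ ℂ with q(a) ≠ 0 and R'(a) ≠ 0. Then for every z ∈ ℂ that is not a critical value of R and with z ∉ {R(a), d_1, …, d_{2d−2}}, one has Σ_{y ∈ ℂ, R(y)=z} 1/((y − a)·(R'(y))²) = 1/(R'(a)·(z − R(a))) + Σ_{i=1}^{2d−2} b_i/((c_i − a)·(z − d_i)). (This is the identity R*(τ_a) = τ_{R(a)}/R'(a) + Σ_i b_i τ_a(c_i) τ_{d_i}.) -/

import Mathlib

open MeasureTheory Polynomial Filter Topology

noncomputable section

/-- The rational map `R = p/q` as a function on `ℂ`. -/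
def Rfun (p q : Polynomial ℂ) : ℂ → ℂ := fun z => p.eval z / q.eval z

/-- `z ∈ ℂ` is a critical value of `R = p/q`. -/
def IsCritValue (p q : Polynomial ℂ) (z : ℂ) : Prop :=
  ∃ c : ℂ, q.eval c ≠ 0 ∧ deriv (Rfun p q) c = 0 ∧ Rfun p q c = z

/-- The Ruelle (transfer) operator: `(R*φ)(z) = ∑_{R(y) = z} φ(y)/(R'(y))²`,
the sum being over the fiber of `R = p/q` over `z`. -/
def ruelleOp (p q : Polynomial ℂ) (φ : ℂ → ℂ) : ℂ → ℂ := fun z =>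
  ∑' y : {y : ℂ // q.eval y ≠ 0 ∧ Rfun p q y = z},
    φ (y : ℂ) / (deriv (Rfun p q) (y : ℂ)) ^ 2

/-- `(Rⁿ)'(a) = ∏_{j<n} R'(Rʲ(a))`. -/
def derivIter (p q : Polynomial ℂ) (n : ℕ) (a : ℂ) : ℂ :=
  ∏ j ∈ Finset.range n, deriv (Rfun p q) ((Rfun p q)^[j] a)

/-- `γ_a(z) = a(a-1)/(z(z-1)(z-a))`. -/
def gam (a z : ℂ) : ℂ := a * (a - 1) / (z * (z - 1) * (z - a))


/-- If the finite set `s` exhausts the zeros of `D` counted with multiplicity, and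
`deg f + 2 ≤ deg D`, then the residues of `f / D` sum to zero. -/
theorem sum_eval_div_eval_derivative_eq_zero {F : Type*} [Field F] {f D : F[X]} {s : Finset F}
    (hD : D ≠ 0) (hroot : ∀ x ∈ s, D.IsRoot x) (hdeg : D.natDegree ≤ s.card)
    (hf : f.natDegree + 2 ≤ s.card) :
    ∑ x ∈ s, f.eval x / D.derivative.eval x = 0 := by
  classical
  have hle : s.val ≤ D.roots :=
    (Multiset.le_iff_subset s.nodup).2 fun x hx => (mem_roots hD).2 (hroot x hx)
  have hroots : s.val = D.roots :=
    Multiset.eq_of_le_of_card_le hle ((card_roots' D).trans hdeg)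
  have hprod : D = C D.leadingCoeff * Lagrange.nodal s id := by
    rw [Lagrange.nodal_eq]
    refine (C_leadingCoeff_mul_prod_multiset_X_sub_C ?_).symm.trans ?_
    · exact le_antisymm (card_roots' D) (by rw [← hroots]; exact hdeg)
    · rw [← hroots]; rfl
  have hcoeff := Lagrange.coeff_eq_sum (s := s) (v := id) Function.injective_id.injOn (P := f)
    (degree_le_natDegree.trans_lt (by exact_mod_cast (by omega : f.natDegree < s.card)))
  rw [coeff_eq_zero_of_natDegree_lt (by omega)] at hcoeff
  have hterm : ∀ x ∈ s, f.eval x / D.derivative.eval x =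
      D.leadingCoeff⁻¹ * (f.eval (id x) / ∏ y ∈ s.erase x, (id x - id y)) := by
    intro x hx
    have hnodal := Lagrange.eval_nodal_derivative_eval_node_eq (v := id) hx
    rw [Lagrange.eval_nodal] at hnodal
    rw [hprod, derivative_C_mul, eval_C_mul, ← hprod, ← hnodal, div_eq_mul_inv, div_eq_mul_inv,
      mul_inv]
    simp only [id]
    ring
  rw [Finset.sum_congr rfl hterm, ← Finset.mul_sum, ← hcoeff, mul_zero]

/-- The numerator `p' q - p q'` of the derivative of `p / q`. -/
def derivNumer (p q : ℂ[X]) : ℂ[X] := derivative p * q - p * derivative q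

theorem natDegree_derivNumer_le {d : ℕ} {p q : ℂ[X]} (hd : 2 ≤ d) (hp : p.natDegree = d)
    (hq : q.natDegree = d - 1) : (derivNumer p q).natDegree ≤ 2 * d - 2 := by
  have hp' := natDegree_derivative_le p
  have hq' := natDegree_derivative_le q
  refine (natDegree_sub_le _ _).trans (max_le ?_ ?_) <;>
    refine natDegree_mul_le.trans ?_ <;> omega

theorem deriv_Rfun {p q : ℂ[X]} {x : ℂ} (hx : q.eval x ≠ 0) :
    deriv (Rfun p q) x = (derivNumer p q).eval x / q.eval x ^ 2 := by
  refine ((p.hasDerivAt x).div (q.hasDerivAt x) hx).deriv.trans ?_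
  simp [derivNumer]

theorem deriv_deriv_Rfun {p q : ℂ[X]} {x : ℂ} (hx : q.eval x ≠ 0)
    (hcrit : (derivNumer p q).eval x = 0) :
    deriv (deriv (Rfun p q)) x = (derivNumer p q).derivative.eval x / q.eval x ^ 2 := by
  have heq : deriv (Rfun p q) =ᶠ[𝓝 x]
      fun w => (derivNumer p q).eval w / q.eval w ^ 2 :=
    (q.continuous.continuousAt.eventually_ne hx).mono fun w hw => deriv_Rfun hw
  rw [heq.deriv_eq]
  refine (((derivNumer p q).hasDerivAt x).div ((q.hasDerivAt x).pow 2)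
    (pow_ne_zero 2 hx)).deriv.trans ?_
  rw [hcrit]
  simp only [Pi.pow_apply]
  field_simp
  ring

theorem eval_ne_zero_of_isRoot_sub_C_mul {p q : ℂ[X]} (hcop : IsCoprime p q) {x z : ℂ}
    (hx : (p - C z * q).IsRoot x) : q.eval x ≠ 0 := by
  intro hq
  obtain ⟨u, v, huv⟩ := hcop
  have hp : p.eval x = 0 := by simpa [IsRoot, hq] using hx
  simpa [hp, hq] using congrArg (eval x) huv

theorem isRoot_sub_C_mul_iff {p q : ℂ[X]} {x z : ℂ} (hx : q.eval x ≠ 0) :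
    (p - C z * q).IsRoot x ↔ Rfun p q x = z := by
  simp [IsRoot, Rfun, div_eq_iff hx, sub_eq_zero]

theorem eval_sub_C_mul {p q : ℂ[X]} {x : ℂ} (z : ℂ) (hx : q.eval x ≠ 0) :
    (p - C z * q).eval x = q.eval x * (Rfun p q x - z) := by
  simp only [Rfun, eval_sub, eval_mul, eval_C]
  field_simp

theorem eval_derivNumer_of_Rfun_eq {p q : ℂ[X]} {x z : ℂ} (hx : q.eval x ≠ 0)
    (hz : Rfun p q x = z) :
    (derivNumer p q).eval x = q.eval x * (p - C z * q).derivative.eval x := by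
  have hp : p.eval x = z * q.eval x := (div_eq_iff hx).1 hz
  simp only [derivNumer, derivative_sub, derivative_C_mul, eval_sub, eval_mul, eval_C, hp]
  ring

theorem ruelle_of_tau (d : ℕ) (hd : 2 ≤ d) (p q : Polynomial ℂ) (hcop : IsCoprime p q)
    (hdp : p.natDegree = d) (hdq : q.natDegree = d - 1)
    (c : Fin (2 * d - 2) → ℂ) (hcinj : Function.Injective c)
    (hcq : ∀ i, q.eval (c i) ≠ 0)
    (hcderiv : ∀ i, deriv (Rfun p q) (c i) = 0)
    (hcsimple : ∀ i, deriv (deriv (Rfun p q)) (c i) ≠ 0)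
    (hcall : ∀ z : ℂ, q.eval z ≠ 0 → deriv (Rfun p q) z = 0 → ∃ i, c i = z)
    (a : ℂ) (haq : q.eval a ≠ 0) (hader : deriv (Rfun p q) a ≠ 0) :
    ∀ z : ℂ, ¬ IsCritValue p q z → z ≠ Rfun p q a → (∀ i, z ≠ Rfun p q (c i)) →
      (∑' y : {y : ℂ // q.eval y ≠ 0 ∧ Rfun p q y = z},
          1 / (((y : ℂ) - a) * (deriv (Rfun p q) (y : ℂ)) ^ 2)) =
        1 / (deriv (Rfun p q) a * (z - Rfun p q a)) +
          ∑ i, (1 / deriv (deriv (Rfun p q)) (c i)) /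
            ((c i - a) * (z - Rfun p q (c i))) := by
  intro z hz hza hzc
  classical
  set P : ℂ[X] := p - C z * q with hP
  set N : ℂ[X] := derivNumer p q with hN
  have hPdeg : P.natDegree = d := by
    rw [hP, natDegree_sub_eq_left_of_natDegree_lt, hdp]
    exact (natDegree_C_mul_le z q).trans_lt (by omega)
  have hP0 : P ≠ 0 := by
    rintro h
    rw [h, natDegree_zero] at hPdeg
    omega
  have hNa : N.eval a ≠ 0 := fun h => hader (by rw [deriv_Rfun haq, ← hN, h, zero_div])
  have hN0 : N ≠ 0 := by
    rintro h
    simp [h] at hNa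
  have hNc : ∀ i, N.eval (c i) = 0 := fun i => by
    have h := hcderiv i
    rw [deriv_Rfun (hcq i)] at h
    exact (div_eq_zero_iff.1 h).resolve_right (pow_ne_zero 2 (hcq i))
  have hPa : P.eval a ≠ 0 := by
    rw [hP, eval_sub_C_mul z haq]
    exact mul_ne_zero haq (sub_ne_zero.2 hza.symm)
  have hPc : ∀ i, P.eval (c i) ≠ 0 := fun i => by
    rw [hP, eval_sub_C_mul z (hcq i)]
    exact mul_ne_zero (hcq i) (sub_ne_zero.2 (hzc i).symm)
  set T : Finset ℂ := P.roots.toFinset with hT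
  have hTroot : ∀ {y}, y ∈ T ↔ P.IsRoot y := fun {y} => by
    rw [hT, Multiset.mem_toFinset, mem_roots hP0]
  have hTq : ∀ y ∈ T, q.eval y ≠ 0 := fun y hy =>
    eval_ne_zero_of_isRoot_sub_C_mul hcop (hTroot.1 hy)
  have hTR : ∀ y ∈ T, Rfun p q y = z := fun y hy =>
    (isRoot_sub_C_mul_iff (hTq y hy)).1 (hTroot.1 hy)
  have hTN : ∀ y ∈ T, N.eval y = q.eval y * P.derivative.eval y := fun y hy =>
    eval_derivNumer_of_Rfun_eq (hTq y hy) (hTR y hy)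
  have hTN0 : ∀ y ∈ T, N.eval y ≠ 0 := fun y hy h =>
    hz ⟨y, hTq y hy, by rw [deriv_Rfun (hTq y hy), ← hN, h, zero_div], hTR y hy⟩
  have hTcard : T.card = d := by
    rw [hT, Multiset.toFinset_card_of_nodup, (IsAlgClosed.splits P).natDegree_eq_card_roots.symm,
      hPdeg]
    refine Multiset.nodup_iff_count_le_one.2 fun y => ?_
    rw [count_roots]
    by_contra! h
    have hy := (one_lt_rootMultiplicity_iff_isRoot hP0).1 h
    exact hTN0 y (hTroot.2 hy.1) (by rw [hTN y (hTroot.2 hy.1), hy.2, mul_zero])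
  set U : Finset ℂ := Finset.univ.image c with hU
  have hUcard : U.card = 2 * d - 2 := by
    rw [hU, Finset.card_image_of_injective _ hcinj, Finset.card_univ, Fintype.card_fin]
  have hUT : Disjoint U T := by
    refine Finset.disjoint_left.2 fun y hy hyT => ?_
    obtain ⟨i, -, rfl⟩ := Finset.mem_image.1 hy
    exact hPc i (hTroot.1 hyT)
  have haUT : a ∉ U ∪ T := by
    rw [Finset.mem_union, not_or]
    refine ⟨fun hy => ?_, fun hy => hPa (hTroot.1 hy)⟩
    obtain ⟨i, -, hi⟩ := Finset.mem_image.1 hy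
    exact hNa (hi ▸ hNc i)
  have hcard : (insert a (U ∪ T)).card = 2 * d - 2 + d + 1 := by
    rw [Finset.card_insert_of_notMem haUT, Finset.card_union_of_disjoint hUT, hUcard, hTcard]
  have hres := sum_eval_div_eval_derivative_eq_zero (f := q ^ 3) (D := (X - C a) * (N * P))
    (s := insert a (U ∪ T)) (mul_ne_zero (X_sub_C_ne_zero a) (mul_ne_zero hN0 hP0))
    (by
      intro x hx
      rw [IsRoot, eval_mul, eval_mul]
      rcases Finset.mem_insert.1 hx with rfl | hx
      · simp
      rcases Finset.mem_union.1 hx with hx | hx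
      · obtain ⟨i, -, rfl⟩ := Finset.mem_image.1 hx
        simp [hNc i]
      · simp [(hTroot.1 hx).eq_zero])
    (by
      have hNdeg : N.natDegree ≤ 2 * d - 2 := natDegree_derivNumer_le hd hdp hdq
      have h1 := natDegree_mul_le (p := X - C a) (q := N * P)
      have h2 := natDegree_mul_le (p := N) (q := P)
      rw [natDegree_X_sub_C] at h1
      omega)
    (by
      rw [natDegree_pow, hdq, hcard]
      omega)
  have hD : ∀ x, ((X - C a) * (N * P)).derivative.eval x = N.eval x * P.eval x +
      (x - a) * (N.derivative.eval x * P.eval x + N.eval x * P.derivative.eval x) := fun x => by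
    simp [derivative_mul]
  rw [Finset.sum_insert haUT, Finset.sum_union hUT, hU,
    Finset.sum_image fun _ _ _ _ h => hcinj h] at hres
  have hterm_a : (q ^ 3).eval a / ((X - C a) * (N * P)).derivative.eval a =
      -(1 / (deriv (Rfun p q) a * (z - Rfun p q a))) := by
    have h : z - Rfun p q a ≠ 0 := sub_ne_zero.2 hza
    rw [hD, deriv_Rfun haq, ← hN, hP, eval_sub_C_mul z haq, eval_pow, ← neg_sub z]
    field_simp
    simp
  have hterm_c : ∀ i, (q ^ 3).eval (c i) / ((X - C a) * (N * P)).derivative.eval (c i) =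
      -((1 / deriv (deriv (Rfun p q)) (c i)) / ((c i - a) * (z - Rfun p q (c i)))) := fun i => by
    have h : z - Rfun p q (c i) ≠ 0 := sub_ne_zero.2 (hzc i)
    have hca : c i - a ≠ 0 := sub_ne_zero.2 fun h => hNa (h ▸ hNc i)
    have hqi := hcq i
    have h2 := hcsimple i
    rw [deriv_deriv_Rfun hqi (hNc i), ← hN] at h2
    have hN' : N.derivative.eval (c i) ≠ 0 := fun h => h2 (by rw [h, zero_div])
    rw [hD, deriv_deriv_Rfun hqi (hNc i), ← hN, hNc i, hP, eval_sub_C_mul z hqi, eval_pow,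
      ← neg_sub z]
    simp only [zero_mul, zero_add, add_zero]
    field_simp
  have hterm_y : ∀ y ∈ T, (q ^ 3).eval y / ((X - C a) * (N * P)).derivative.eval y =
      1 / ((y - a) * deriv (Rfun p q) y ^ 2) := fun y hy => by
    have hya : y - a ≠ 0 := sub_ne_zero.2 fun h => hPa (h ▸ hTroot.1 hy)
    have hqy := hTq y hy
    have hNy := hTN0 y hy
    have hP' : P.derivative.eval y = N.eval y / q.eval y := by
      rw [hTN y hy, mul_div_cancel_left₀ _ hqy]
    rw [hD, deriv_Rfun hqy, ← hN, hP', (hTroot.1 hy).eq_zero, eval_pow]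
    simp only [mul_zero, zero_add]
    field_simp
  rw [hterm_a, Finset.sum_congr rfl fun i _ => hterm_c i, Finset.sum_congr rfl hterm_y,
    Finset.sum_neg_distrib] at hres
  have hfiber : {y : ℂ | q.eval y ≠ 0 ∧ Rfun p q y = z} = (T : Set ℂ) := by
    ext y
    exact ⟨fun hy => hTroot.2 ((isRoot_sub_C_mul_iff hy.1).2 hy.2),
      fun hy => ⟨hTq y hy, hTR y hy⟩⟩
  have hsum : (∑' y : {y : ℂ // q.eval y ≠ 0 ∧ Rfun p q y = z},
      1 / (((y : ℂ) - a) * (deriv (Rfun p q) (y : ℂ)) ^ 2)) =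
      ∑ y ∈ T, 1 / ((y - a) * deriv (Rfun p q) y ^ 2) := by
    rw [← Finset.tsum_subtype' T fun y => 1 / ((y - a) * deriv (Rfun p q) y ^ 2), ← hfiber]
    rfl
  rw [hsum]
  linear_combination hres

end
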